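/- Let N be an ℕ-valued random variable with E[N^{1+δ}] < ∞ for some δ > 0, and let {Xᵢ}_{i≥1} be an arbitrary sequence of nonnegative random variables on the same probability space. Then for every r > 1 and every p with 1 < p < r(1+δ)/(r+δ), one has E[(Σ_{i=1}^N Xᵢ^{1/r})^p] ≤ E[N^{(r−1)p/(r−p)}]^{(r−p)/r} · E[Σ_{i=1}^N Xᵢ]^{p/r}; moreover (r−1)p/(r−p) ≤ 1+δ, so the first factor on the right-hand side is finite. -/

import Mathlib

open MeasureTheory ProbabilityTheory Filter Topology
open scoped ENNReal NNReal

/-- Jensen's inequality for finite sums: `(∑ aᵢ ^ (1/r)) ^ r ≤ #s ^ (r - 1) * ∑ aᵢ`. -/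
lemma sum_rpow_one_div_rpow_le {ι : Type*} (s : Finset ι) (a : ι → ℝ≥0∞) {r : ℝ} (hr : 1 < r) :
    (∑ i ∈ s, a i ^ (1 / r)) ^ r ≤ (s.card : ℝ≥0∞) ^ (r - 1) * ∑ i ∈ s, a i := by
  have hr0 : r ≠ 0 := by positivity
  have h := ENNReal.inner_le_Lp_mul_Lq s (fun _ => 1) (fun i => a i ^ (1 / r))
    (Real.HolderConjugate.conjExponent hr).symm
  simp only [one_mul, ENNReal.one_rpow, Finset.sum_const, nsmul_eq_mul, mul_one,
    ← ENNReal.rpow_mul, one_div_mul_cancel hr0, ENNReal.rpow_one] at h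
  calc (∑ i ∈ s, a i ^ (1 / r)) ^ r
      ≤ ((s.card : ℝ≥0∞) ^ (1 / r.conjExponent) * (∑ i ∈ s, a i) ^ (1 / r)) ^ r :=
        ENNReal.rpow_le_rpow h (by positivity)
    _ = _ := by
        rw [ENNReal.mul_rpow_of_nonneg _ _ (by positivity), ← ENNReal.rpow_mul,
          ← ENNReal.rpow_mul, one_div_mul_cancel hr0, ENNReal.rpow_one]
        congr 2
        have : r - 1 ≠ 0 := by linarith
        rw [Real.conjExponent]
        field_simp

lemma natCast_rpow_le_rpow (n : ℕ) {s t : ℝ} (hs : 0 < s) (hst : s ≤ t) :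
    (n : ℝ≥0∞) ^ s ≤ (n : ℝ≥0∞) ^ t := by
  rcases Nat.eq_zero_or_pos n with rfl | hn
  · simp [ENNReal.zero_rpow_of_pos hs]
  · exact ENNReal.rpow_le_rpow_of_exponent_le (by exact_mod_cast hn) hst

/-- A sum of measurable functions up to a random index is measurable. -/
lemma measurable_sum_Icc_random {Ω : Type*} [MeasurableSpace Ω] {N : Ω → ℕ} (hN : Measurable N)
    {f : ℕ → Ω → ℝ≥0∞} (hf : ∀ i, Measurable (f i)) :
    Measurable fun ω => ∑ i ∈ Finset.Icc 1 (N ω), f i ω := by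
  have h : Measurable fun x : ℕ × Ω => ∑ i ∈ Finset.Icc 1 x.1, f i x.2 :=
    measurable_from_prod_countable_right fun n =>
      Finset.measurable_fun_sum (Finset.Icc 1 n) fun i _ => hf i
  exact h.comp (hN.prodMk measurable_id)

/-- if `E[N^{1+δ}] < ∞` and `{Xᵢ}` are arbitrary nonnegative random
variables, then for `r > 1` and `1 < p < r(1+δ)/(r+δ)`,
`E[(Σ_{i=1}^N Xᵢ^{1/r})^p] ≤ E[N^{(r-1)p/(r-p)}]^{(r-p)/r} E[Σ_{i=1}^N Xᵢ]^{p/r}`;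
moreover `(r-1)p/(r-p) ≤ 1+δ`, so the first factor on the right-hand side is finite. -/
theorem stmt9 {Ω : Type*} [MeasurableSpace Ω] (P : Measure Ω) [IsProbabilityMeasure P]
    (N : Ω → ℕ) (hN : Measurable N)
    (X : ℕ → Ω → ℝ) (hXmeas : ∀ i, Measurable (X i)) (hXnn : ∀ i ω, 0 ≤ X i ω)
    (δ : ℝ) (hδ : 0 < δ) (hNmom : ∫⁻ ω, (N ω : ℝ≥0∞) ^ ((1 : ℝ) + δ) ∂P < ⊤)
    (r p : ℝ) (hr : 1 < r) (hp1 : 1 < p) (hp2 : p < r * (1 + δ) / (r + δ)) :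
    ((r - 1) * p / (r - p) ≤ 1 + δ) ∧
    (∫⁻ ω, (N ω : ℝ≥0∞) ^ ((r - 1) * p / (r - p)) ∂P < ⊤) ∧
    ∫⁻ ω, (∑ i ∈ Finset.Icc 1 (N ω), ENNReal.ofReal (X i ω ^ (1 / r))) ^ p ∂P
      ≤ (∫⁻ ω, (N ω : ℝ≥0∞) ^ ((r - 1) * p / (r - p)) ∂P) ^ ((r - p) / r)
        * (∫⁻ ω, ∑ i ∈ Finset.Icc 1 (N ω), ENNReal.ofReal (X i ω) ∂P) ^ (p / r) := by
  have hrδ : 0 < r + δ := by linarith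
  have hr0 : 0 < r := by linarith
  have hp0 : 0 < p := by linarith
  rw [lt_div_iff₀ hrδ] at hp2
  have hpr : p < r := by nlinarith
  have hrp : 0 < r - p := by linarith
  have hq : 0 < (r - 1) * p / (r - p) := div_pos (mul_pos (by linarith) hp0) hrp
  have hqle : (r - 1) * p / (r - p) ≤ 1 + δ := by
    rw [div_le_iff₀ hrp]
    linarith
  refine ⟨hqle, (lintegral_mono fun ω => natCast_rpow_le_rpow (N ω) hq hqle).trans_lt hNmom, ?_⟩
  have hX : ∀ i, Measurable fun ω => ENNReal.ofReal (X i ω) := fun i => (hXmeas i).ennreal_ofReal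
  have hNq : Measurable fun ω => (N ω : ℝ≥0∞) ^ ((r - 1) * p / (r - p)) :=
    ((measurable_of_countable (fun n : ℕ => (n : ℝ≥0∞))).comp hN).pow_const _
  refine le_trans (lintegral_mono fun ω => ?_)
    (ENNReal.lintegral_mul_norm_pow_le hNq.aemeasurable
      (measurable_sum_Icc_random hN hX).aemeasurable (div_nonneg hrp.le hr0.le)
      (div_nonneg hp0.le hr0.le) (by field_simp; ring))
  have hJ := sum_rpow_one_div_rpow_le (Finset.Icc 1 (N ω)) (fun i => ENNReal.ofReal (X i ω)) hr
  rw [Nat.card_Icc, Nat.add_sub_cancel] at hJ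
  have hterm : ∀ i, ENNReal.ofReal (X i ω ^ (1 / r)) = ENNReal.ofReal (X i ω) ^ (1 / r) :=
    fun i => (ENNReal.ofReal_rpow_of_nonneg (hXnn i ω) (by positivity)).symm
  simp only [hterm]
  have hpow := ENNReal.rpow_le_rpow hJ (div_nonneg hp0.le hr0.le)
  rw [← ENNReal.rpow_mul, mul_div_cancel₀ _ hr0.ne',
    ENNReal.mul_rpow_of_nonneg _ _ (div_nonneg hp0.le hr0.le), ← ENNReal.rpow_mul] at hpow
  rw [← ENNReal.rpow_mul]
  convert hpow using 3
  field_simp
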